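/- arXiv:1704.05770 — 4 statements merged into one kernel-verified Lean document; each statement's English description precedes it below -/
import Mathlib

section
/- For every n : ℕ, every k ≥ 2, and every base point x : Sⁿ, the k-th homotopy group of Sⁿ at x is isomorphic as a group to the k-th homotopy group of ℝPⁿ at p x. (Corollary of the fiber sequence S⁰ ↪ Sⁿ ↠ ℝPⁿ via the long exact sequence of homotopy groups.) -/
/-- The `n`-sphere, the unit sphere in `(n+1)`-dimensional Euclidean space. -/
abbrev Sph (n : ℕ) : Type :=
  Metric.sphere (0 : EuclideanSpace ℝ (Fin (n + 1))) 1

/-- The relation identifying `x` with `-x` on the `n`-sphere. -/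
def antipodalRel (n : ℕ) (x y : Sph n) : Prop :=
  (y : EuclideanSpace ℝ (Fin (n + 1))) = -(x : EuclideanSpace ℝ (Fin (n + 1)))

/-- Real projective `n`-space, the antipodal quotient of the `n`-sphere with the
quotient topology. -/
abbrev RP (n : ℕ) : Type := Quot (antipodalRel n)

/-- The quotient map `Sⁿ → ℝPⁿ`. -/
def proj (n : ℕ) : Sph n → RP n := Quot.mk (antipodalRel n)

open scoped unitInterval Topology Topology.Homotopy

section Covering

variable {N E X : Type*} [TopologicalSpace E] [TopologicalSpace X]

/-- The generalized loop obtained by postcomposition with a continuous map. -/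
def GenLoop.map (f : C(E, X)) {e : E} (γ : Ω^ N E e) : Ω^ N X (f e) :=
  ⟨f.comp γ.1, fun y hy ↦ congrArg f (γ.2 y hy)⟩

theorem GenLoop.Homotopic.map (f : C(E, X)) {e : E} {γ γ' : Ω^ N E e}
    (h : GenLoop.Homotopic γ γ') : GenLoop.Homotopic (GenLoop.map f γ) (GenLoop.map f γ') :=
  h.comp_continuousMap f

theorem GenLoop.map_transAt [DecidableEq N] (f : C(E, X)) {e : E} (i : N) (γ γ' : Ω^ N E e) :
    GenLoop.map f (GenLoop.transAt i γ γ') =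
      GenLoop.transAt i (GenLoop.map f γ) (GenLoop.map f γ') :=
  GenLoop.ext _ _ fun _ ↦ apply_ite f _ _ _

/-- The homomorphism of homotopy groups induced by a continuous map. -/
noncomputable def HomotopyGroup.map [DecidableEq N] [Nonempty N] (f : C(E, X)) (e : E) :
    HomotopyGroup N E e →* HomotopyGroup N X (f e) :=
  MonoidHom.mk' (Quotient.map (GenLoop.map f) fun _ _ ↦ GenLoop.Homotopic.map f) <| by
    rintro ⟨a⟩ ⟨b⟩
    let i := Classical.arbitrary N
    exact (congrArg (Quotient.map (GenLoop.map f) fun _ _ ↦ GenLoop.Homotopic.map f)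
      (HomotopyGroup.mul_spec (i := i) (p := a) (q := b))).trans <|
      (congrArg (Quotient.mk _) (GenLoop.map_transAt f i b a)).trans
        (HomotopyGroup.mul_spec (i := i) (p := GenLoop.map f a) (q := GenLoop.map f b)).symm

variable {p : E → X}

namespace IsCoveringMap

variable (cov : IsCoveringMap p)
include cov

/-- If the composition of a map from a cube of dimension at least two with a covering map is
constant on the boundary, then so is the map itself. -/
theorem eqOn_cube_boundary [Nontrivial N] (F : C(I^N, E)) {x : X}
    (hF : ∀ y ∈ Cube.boundary N, p (F y) = x) : ∀ y ∈ Cube.boundary N, F y = F 0 := by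
  classical
  have face (i : N) (a : I) (ha : a = 0 ∨ a = 1) (y z : I^N) (hy : y i = a) (hz : z i = a) :
      F y = F z := by
    have := cov.const_of_comp (g := fun w : I^N ↦ F (Function.update w i a)) (by fun_prop)
      (fun w w' ↦ by
        rw [hF _ ⟨i, by simpa using ha⟩, hF _ ⟨i, by simpa using ha⟩]) y z
    simpa [← hy, Function.update_eq_self, show Function.update z i (y i) = z by
      rw [hy, ← hz, Function.update_eq_self]] using this
  rintro y ⟨i, hi⟩
  obtain ⟨j, hj⟩ := exists_ne i
  exact (face i (y i) hi y (Function.update 0 i (y i)) rfl (by simp)).trans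
    (face j 0 (.inl rfl) _ _ (by simp [hj]) rfl)

/-- Maps from a cube lift through a covering map, with prescribed value at the origin. -/
theorem exists_cube_lift (g : C(I^N, X)) (e : E) (he : g 0 = p e) :
    ∃ F : C(I^N, E), F 0 = e ∧ ∀ y, p (F y) = g y := by
  let H : C(I × (I^N), X) := g.comp ⟨fun ty i ↦ ty.1 * ty.2 i, by fun_prop⟩
  have H_0 (y : I^N) : H (0, y) = p (ContinuousMap.const _ e y) := by
    rw [ContinuousMap.const_apply, ← he]
    exact congrArg g (funext fun i ↦ zero_mul _)
  have lifts (ty) : p (cov.liftHomotopy H (.const _ e) H_0 ty) = H ty :=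
    congrFun (cov.liftHomotopy_lifts H (.const _ e) H_0) ty
  refine ⟨(cov.liftHomotopy H (.const _ e) H_0).comp ⟨fun y ↦ (1, y), by fun_prop⟩, ?_,
    fun y ↦ (lifts (1, y)).trans (congrArg g (funext fun i ↦ one_mul _))⟩
  refine (cov.const_of_comp (g := fun t ↦ cov.liftHomotopy H (.const _ e) H_0 (t, 0))
    (by fun_prop) (fun t t' ↦ ?_) 1 0).trans (cov.liftHomotopy_zero H (.const _ e) H_0 0)
  rw [lifts, lifts]
  exact congrArg g (funext fun i ↦ (mul_zero _).trans (mul_zero _).symm)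

/-- A covering map induces a bijection on homotopy groups of dimension at least two. -/
theorem bijective_homotopyGroupMap [DecidableEq N] [Nonempty N] [Nontrivial N] (e : E) :
    Function.Bijective (HomotopyGroup.map (N := N) ⟨p, cov.continuous⟩ e) := by
  have zero_mem : (0 : I^N) ∈ Cube.boundary N := ⟨Classical.arbitrary N, .inl rfl⟩
  constructor
  · rintro ⟨a⟩ ⟨b⟩ h
    exact Quotient.sound <| (cov.homotopicRel_iff_comp
      ⟨0, zero_mem, (a.2 0 zero_mem).trans (b.2 0 zero_mem).symm⟩).mpr (Quotient.exact h)
  · rintro ⟨g⟩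
    obtain ⟨F, F_0, hF⟩ := cov.exists_cube_lift g.1 e (g.2 0 zero_mem)
    refine ⟨⟦⟨F, fun y hy ↦ (cov.eqOn_cube_boundary F (x := p e)
      (fun z hz ↦ (hF z).trans (g.2 z hz)) y hy).trans F_0⟩⟧, ?_⟩
    exact congrArg (Quotient.mk _) (GenLoop.ext _ _ hF)

end IsCoveringMap

end Covering

/-- The action of the sign group `ℤˣ` on the sphere, in which `-1` is the antipodal map. -/
@[reducible]
def antipodalAction (n : ℕ) : MulAction ℤˣ (Sph n) where
  smul u x := ⟨u • (x : EuclideanSpace ℝ (Fin (n + 1))), by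
    obtain rfl | rfl := Int.units_eq_one_or u <;> simp⟩
  one_smul x := Subtype.ext (one_smul ℤˣ (x : EuclideanSpace ℝ (Fin (n + 1))))
  mul_smul u v x := Subtype.ext (mul_smul u v (x : EuclideanSpace ℝ (Fin (n + 1))))

theorem proj_eq_iff {n : ℕ} {x y : Sph n} : proj n x = proj n y ↔ x = y ∨ x = -y := by
  constructor
  · intro h
    replace h : Relation.EqvGen (antipodalRel n) x y := Quot.eqvGen_exact h
    induction h with
    | rel x y h => exact .inr (Subtype.ext (neg_eq_iff_eq_neg.mp (Eq.symm h)))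
    | refl x => exact .inl rfl
    | symm x y _ ih => exact ih.imp Eq.symm fun h ↦ by rw [h, neg_neg]
    | trans x y z _ _ ih₁ ih₂ =>
      rcases ih₁ with rfl | rfl <;> rcases ih₂ with rfl | rfl <;> simp
  · rintro (rfl | rfl)
    · rfl
    · exact Quot.sound (by simp [antipodalRel])

theorem isCoveringMap_proj (n : ℕ) : IsCoveringMap (proj n) := by
  let := antipodalAction n
  have neg_smul (x : Sph n) : (-1 : ℤˣ) • x = -x :=
    Subtype.ext (by change (-1 : ℤˣ) • (x : EuclideanSpace ℝ (Fin (n + 1))) = _; simp)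
  have hq : IsQuotientCoveringMap (proj n) ℤˣ :=
    { toIsQuotientMap := isQuotientMap_quot_mk
      continuous_const_smul := fun u ↦ by
        obtain rfl | rfl := Int.units_eq_one_or u
        · simpa only [one_smul] using! continuous_id
        · simpa only [neg_smul] using continuous_neg
      apply_eq_iff_mem_orbit := fun {x y} ↦ by
        rw [proj_eq_iff]
        constructor
        · rintro (rfl | rfl)
          exacts [⟨1, one_smul _ _⟩, ⟨-1, neg_smul _⟩]
        · rintro ⟨u, rfl⟩
          obtain rfl | rfl := Int.units_eq_one_or u
          exacts [.inl (one_smul _ _), .inr (neg_smul _)]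
      disjoint := fun x ↦ ⟨Metric.ball x 1, Metric.ball_mem_nhds x one_pos, fun u ↦ by
        rintro ⟨_, ⟨y, hy, rfl⟩, hy'⟩
        obtain rfl | rfl := Int.units_eq_one_or u
        · rfl
        exfalso
        have h2 : dist y (-y) = 2 := by
          rw [Subtype.dist_eq, dist_eq_norm]
          have : (y : EuclideanSpace ℝ (Fin (n + 1))) - ↑(-y) = (2 : ℝ) • y := by
            rw [two_smul]; simp
          rw [this, norm_smul]; simp
        rw [Metric.mem_ball] at hy hy'
        simp only [neg_smul] at hy'
        linarith [dist_triangle_right y (-y) x]⟩ }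
  exact hq.isCoveringMap

/-- For `k ≥ 2`, the `k`-th homotopy group of `Sⁿ` is isomorphic to that of `ℝPⁿ`. -/
theorem stmt_8 (n k : ℕ) (hk : 2 ≤ k) (x : Sph n) :
    haveI : NeZero k := ⟨by omega⟩
    Nonempty
      (HomotopyGroup (Fin k) (Sph n) x ≃* HomotopyGroup (Fin k) (RP n) (proj n x)) := by
  have : NeZero k := ⟨by omega⟩
  have : Nontrivial (Fin k) := Fin.nontrivial_iff_two_le.mpr hk
  exact ⟨MulEquiv.ofBijective _ ((isCoveringMap_proj n).bijective_homotopyGroupMap x)⟩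
end

section
/- For every n ≥ 2 and every base point y : ℝPⁿ, the fundamental group of ℝPⁿ at y is isomorphic to ℤ/2ℤ (ZMod 2). -/
section SimplyConnectedUnion

open Path.Homotopic Set

variable {X : Type*} [TopologicalSpace X]

/-- Two paths with the same endpoints in a simply connected set are homotopic. -/
theorem IsSimplyConnected.path_homotopic {s : Set X} (hs : IsSimplyConnected s) {x y : X}
    {p q : Path x y} (hp : ∀ t, p t ∈ s) (hq : ∀ t, q t ∈ s) : p.Homotopic q := by
  have := hs.simplyConnectedSpace
  have hx : x ∈ s := by simpa using hp 0
  have hy : y ∈ s := by simpa using hp 1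
  let p' : Path (⟨x, hx⟩ : s) ⟨y, hy⟩ :=
    { toFun := fun t ↦ ⟨p t, hp t⟩, source' := by simp, target' := by simp }
  let q' : Path (⟨x, hx⟩ : s) ⟨y, hy⟩ :=
    { toFun := fun t ↦ ⟨q t, hq t⟩, source' := by simp, target' := by simp }
  exact (SimplyConnectedSpace.paths_homotopic p' q').map ⟨Subtype.val, continuous_subtype_val⟩

/-- A choice of classes of paths from `x₀` to every point which is compatible with all paths that
lie in a member of an open cover is compatible with every path. -/
theorem Path.Homotopic.Quotient.trans_mk_eq_of_open_cover {ι : Type*} {U : ι → Set X}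
    (hU : ∀ i, IsOpen (U i)) (hcover : ∀ x, ∃ i, x ∈ U i) {x₀ : X}
    (c : ∀ x, Path.Homotopic.Quotient x₀ x)
    (hc : ∀ (i : ι) (a b : X) (γ : Path a b), (∀ t, γ t ∈ U i) → (c a).trans (mk γ) = c b)
    {a b : X} (γ : Path a b) : (c a).trans (mk γ) = c b := by
  obtain ⟨t, t_zero, t_mono, ⟨N, hN⟩, ht⟩ :=
    exists_monotone_Icc_subset_open_cover_unitInterval (c := fun i ↦ γ ⁻¹' U i)
      (fun i ↦ (hU i).preimage γ.continuous)
      (fun s _ ↦ mem_iUnion.mpr (hcover (γ s)))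
  have key (n : ℕ) : (c (γ 0)).trans (mk (γ.subpath 0 (t n))) = c (γ (t n)) := by
    induction n with
    | zero =>
      rw [t_zero, Path.subpath_self, mk_refl, trans_refl]
    | succ n ih =>
      obtain ⟨i, hi⟩ := ht n
      have hstep := hc i _ _ (γ.subpath (t n) (t (n + 1))) fun s ↦ by
        have hs := mem_range_self (f := γ.subpath (t n) (t (n + 1))) s
        rw [Path.range_subpath_of_le _ _ _ (t_mono n.le_succ)] at hs
        obtain ⟨r, hr, hrs⟩ := hs
        exact hrs ▸ hi hr
      rw [← hstep, ← ih, trans_assoc, ← mk_trans]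
      congr 1
      exact Path.Homotopic.Quotient.eq.mpr
        ⟨(Path.Homotopy.subpathTransSubpath γ 0 (t n) (t (n + 1))).symm⟩
  have h := key N
  rw [hN N le_rfl, Path.subpath_zero_one] at h
  have cast_eq {x y : X} (hx : x = a) (hy : y = b)
      (h : (c x).trans (mk (γ.cast hx hy)) = c y) : (c a).trans (mk γ) = c b := by
    subst hx hy
    exact h
  exact cast_eq γ.source γ.target h

/-- The union of two simply connected open sets with path connected intersection is simply
connected. -/
theorem simplyConnectedSpace_of_union {U V : Set X} (hU : IsOpen U) (hV : IsOpen V)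
    (hUV : U ∪ V = univ) (scU : IsSimplyConnected U) (scV : IsSimplyConnected V)
    (hpc : IsPathConnected (U ∩ V)) : SimplyConnectedSpace X := by
  obtain ⟨x₀, hx₀⟩ := hpc.nonempty
  have exists_path (x : X) : ∃ p : Path x₀ x,
      (x ∈ U → ∀ t, p t ∈ U) ∧ (x ∈ V → ∀ t, p t ∈ V) := by
    by_cases hxU : x ∈ U
    · by_cases hxV : x ∈ V
      · obtain ⟨p, hp⟩ := hpc.joinedIn x₀ hx₀ x ⟨hxU, hxV⟩
        exact ⟨p, fun _ t ↦ (hp t).1, fun _ t ↦ (hp t).2⟩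
      · obtain ⟨p, hp⟩ := scU.isPathConnected.joinedIn x₀ hx₀.1 x hxU
        exact ⟨p, fun _ ↦ hp, fun h ↦ absurd h hxV⟩
    · have hxV : x ∈ V := (hUV.ge (mem_univ x)).resolve_left hxU
      obtain ⟨p, hp⟩ := scV.isPathConnected.joinedIn x₀ hx₀.2 x hxV
      exact ⟨p, fun h ↦ absurd h hxU, fun _ ↦ hp⟩
  choose p hpU hpV using exists_path
  have trans_mem {s : Set X} {a b : X} {p : Path x₀ a} {γ : Path a b} (hp : ∀ t, p t ∈ s)
      (hγ : ∀ t, γ t ∈ s) (t) : p.trans γ t ∈ s := by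
    rw [Path.trans_apply]
    split_ifs
    exacts [hp _, hγ _]
  have compat {a b : X} (γ : Path a b) :
      (Path.Homotopic.Quotient.mk (p a)).trans (Path.Homotopic.Quotient.mk γ) = Path.Homotopic.Quotient.mk (p b) := by
    refine Path.Homotopic.Quotient.trans_mk_eq_of_open_cover (U := fun i : Bool ↦ cond i U V)
      (by rintro (_ | _) <;> assumption)
      (fun x ↦ (hUV.ge (mem_univ x)).elim (fun h ↦ ⟨true, h⟩) (fun h ↦ ⟨false, h⟩))
      (fun x ↦ Path.Homotopic.Quotient.mk (p x)) ?_ γ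
    rintro (_ | _) a b γ hγ
    · rw [← Path.Homotopic.Quotient.mk_trans]
      refine Path.Homotopic.Quotient.eq.mpr (scV.path_homotopic (trans_mem (hpV a ?_) hγ) (hpV b ?_))
      exacts [by simpa using hγ 0, by simpa using hγ 1]
    · rw [← Path.Homotopic.Quotient.mk_trans]
      refine Path.Homotopic.Quotient.eq.mpr (scU.path_homotopic (trans_mem (hpU a ?_) hγ) (hpU b ?_))
      exacts [by simpa using hγ 0, by simpa using hγ 1]
  rw [simply_connected_iff_paths_homotopic']
  refine ⟨⟨⟨x₀⟩, fun x y ↦ ⟨(p x).symm.trans (p y)⟩⟩, fun {x y} γ γ' ↦ ?_⟩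
  rw [← Path.Homotopic.Quotient.eq]
  have h := congrArg (Path.Homotopic.Quotient.trans (Path.Homotopic.Quotient.mk (p x)).symm)
    ((compat γ).trans (compat γ').symm)
  simpa [← Path.Homotopic.Quotient.trans_assoc] using h

end SimplyConnectedUnion

section Sphere

open Module Metric
open scoped RealInnerProductSpace

variable {E : Type*} [NormedAddCommGroup E] [InnerProductSpace ℝ E]

theorem isSimplyConnected_sphere_compl_singleton (v : sphere (0 : E) 1) :
    IsSimplyConnected ({v}ᶜ : Set (sphere (0 : E) 1)) := by
  have hv := norm_eq_of_mem_sphere v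
  rw [← range_stereographic_symm hv v.2, ← Set.image_univ,
    (isOpenEmbedding_stereographic_symm hv).isEmbedding.isSimplyConnected_image]
  exact (Homeomorph.Set.univ _).toHomotopyEquiv.simplyConnectedSpace

/-- The unit sphere of a Euclidean space of dimension at least three is simply connected. -/
theorem simplyConnectedSpace_sphere {n : ℕ} [Fact (finrank ℝ E = n + 1)] (hn : 2 ≤ n) :
    SimplyConnectedSpace (sphere (0 : E) 1) := by
  have : FiniteDimensional ℝ E := .of_fact_finrank_eq_succ n
  have : Nontrivial E := nontrivial_of_finrank_eq_succ (Fact.out : finrank ℝ E = n + 1)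
  obtain ⟨v⟩ : Nonempty (sphere (0 : E) 1) :=
    (NormedSpace.sphere_nonempty.mpr zero_le_one).to_subtype
  have hv := norm_eq_of_mem_sphere v
  refine simplyConnectedSpace_of_union (U := {v}ᶜ) (V := {-v}ᶜ) isOpen_compl_singleton
    isOpen_compl_singleton ?_ (isSimplyConnected_sphere_compl_singleton v)
    (isSimplyConnected_sphere_compl_singleton (-v)) ?_
  · rw [← Set.compl_inter, Set.compl_univ_iff, Set.singleton_inter_eq_empty,
      Set.mem_singleton_iff]
    exact ne_neg_of_mem_unit_sphere ℝ v
  · have hrank : 1 < Module.rank ℝ (ℝ ∙ (v : E))ᗮ := by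
      rw [← finrank_eq_rank, Submodule.finrank_orthogonal_span_singleton (n := n)
        (ne_zero_of_mem_unit_sphere v)]
      exact_mod_cast hn
    have hsymm : (stereographic hv).symm 0 = -v := by
      rw [← stereographic_apply_neg v]
      exact (stereographic hv).left_inv (by
        simpa using (ne_neg_of_mem_unit_sphere ℝ v).symm)
    have himage : ({v}ᶜ ∩ {-v}ᶜ : Set (sphere (0 : E) 1)) = (stereographic hv).symm '' {0}ᶜ := by
      rw [Set.compl_eq_univ_sdiff {0},
        Set.image_sdiff (isOpenEmbedding_stereographic_symm hv).injective, Set.image_univ,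
        range_stereographic_symm hv v.2, Set.image_singleton, hsymm]
      rfl
    rw [himage]
    exact (isPathConnected_compl_singleton_of_one_lt_rank hrank 0).image
      (isOpenEmbedding_stereographic_symm hv).continuous

end Sphere

/-- The action of `{±1}` on a type with an involutive negation. -/
abbrev unitsIntMulAction (X : Type*) [InvolutiveNeg X] : MulAction ℤˣ X where
  smul u x := if u = 1 then x else -x
  one_smul _ := if_pos rfl
  mul_smul u v x := by
    change (if u * v = 1 then x else -x) =
      if u = 1 then (if v = 1 then x else -x) else -(if v = 1 then x else -x)
    rcases Int.units_eq_one_or u with rfl | rfl <;>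
      rcases Int.units_eq_one_or v with rfl | rfl <;> simp

attribute [local instance] unitsIntMulAction

theorem unitsInt_neg_one_smul {X : Type*} [InvolutiveNeg X] (x : X) : (-1 : ℤˣ) • x = -x :=
  if_neg (by decide)

theorem antipodalRel_iff {n : ℕ} {x y : Sph n} : antipodalRel n x y ↔ y = -x :=
  (Subtype.ext_iff (a1 := y) (a2 := -x)).symm

theorem proj_eq_iff_mem_orbit {n : ℕ} {x y : Sph n} :
    proj n x = proj n y ↔ x ∈ MulAction.orbit ℤˣ y := by
  refine ⟨fun h ↦ ?_, ?_⟩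
  · rw [← MulAction.orbitRel_apply]
    refine Setoid.eqvGen_le (s := MulAction.orbitRel ℤˣ (Sph n)) ?_ (Quot.eqvGen_exact h)
    intro a b hab
    rw [antipodalRel_iff] at hab
    exact ⟨-1, by simp [hab, unitsInt_neg_one_smul]⟩
  · rintro ⟨u, rfl⟩
    rcases Int.units_eq_one_or u with rfl | rfl
    · simp
    · exact (Quot.sound (antipodalRel_iff.mpr (unitsInt_neg_one_smul y))).symm

theorem isQuotientCoveringMap_proj (n : ℕ) : IsQuotientCoveringMap (proj n) ℤˣ := by
  have : ContinuousConstSMul ℤˣ (Sph n) := ⟨fun u ↦ by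
    rcases Int.units_eq_one_or u with rfl | rfl
    · simpa only [one_smul] using continuous_id'
    · simpa only [unitsInt_neg_one_smul] using continuous_neg⟩
  have : IsCancelSMul ℤˣ (Sph n) := isCancelSMul_iff_eq_one_of_smul_eq.mpr fun u x h ↦ by
    rcases Int.units_eq_one_or u with rfl | rfl
    · rfl
    · rw [unitsInt_neg_one_smul] at h
      exact absurd h.symm (ne_neg_of_mem_unit_sphere ℝ x)
  exact isQuotientMap_quot_mk.isQuotientCoveringMap_of_properlyDiscontinuousSMul
    proj_eq_iff_mem_orbit

/-- For `n ≥ 2`, the fundamental group of `ℝPⁿ` is `ℤ/2ℤ`. -/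
theorem stmt_12 (n : ℕ) (hn : 2 ≤ n) (y : RP n) :
    Nonempty (FundamentalGroup (RP n) y ≃* Multiplicative (ZMod 2)) := by
  have : Fact (Module.finrank ℝ (EuclideanSpace ℝ (Fin (n + 1))) = n + 1) := ⟨by simp⟩
  have : SimplyConnectedSpace (Sph n) := simplyConnectedSpace_sphere hn
  obtain ⟨x, hx⟩ := (isQuotientCoveringMap_proj n).surjective y
  have : Fact (Nat.Prime 2) := ⟨Nat.prime_two⟩
  exact ⟨((isQuotientCoveringMap_proj n).fundamentalGroupEquiv ⟨x, hx⟩).trans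
    (mulEquivOfPrimeCardEq (p := 2)
      ((Nat.card_congr MulOpposite.opEquiv.symm).trans
        (Nat.card_eq_fintype_card.trans Fintype.card_units_int))
      (Nat.card_zmod 2))⟩
end

section
/- Let ℝP^∞ be the quotient of S^∞, the unit sphere of ℓ²(ℕ, ℝ), by the relation identifying x with -x, with the quotient topology. Then for every base point y, the fundamental group of ℝP^∞ at y is isomorphic to ℤ/2ℤ (ZMod 2). (ℝP^∞ classifies double covers; it is a K(ℤ/2ℤ, 1) in degree 1.) -/
/-- The infinite-dimensional sphere `S^∞`, the unit sphere of `ℓ²(ℕ, ℝ)`. -/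
abbrev SphInf : Type := Metric.sphere (0 : lp (fun _ : ℕ => ℝ) 2) 1

/-- The relation identifying `x` with `-x` on `S^∞`. -/
def antipodalRelInf (x y : SphInf) : Prop :=
  (y : lp (fun _ : ℕ => ℝ) 2) = -(x : lp (fun _ : ℕ => ℝ) 2)

/-- `ℝP^∞`, the antipodal quotient of `S^∞` with the quotient topology. -/
abbrev RPInf : Type := Quot antipodalRelInf

open Metric unitInterval

section Sphere

variable {E : Type*} [NormedAddCommGroup E]

/-- Two maps to the unit sphere are homotopic if the segments joining their values avoid `0`. -/
theorem homotopic_sphere_of_segment_ne_zero {X : Type*} [TopologicalSpace X] [NormedSpace ℝ E]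
    (f g : C(X, sphere (0 : E) 1))
    (h : ∀ (t : I) (x : X), (1 - (t : ℝ)) • (f x : E) + (t : ℝ) • (g x : E) ≠ 0) :
    f.Homotopic g := by
  refine ⟨⟨⟨fun q : I × X ↦ ⟨‖(1 - (q.1 : ℝ)) • (f q.2 : E) + (q.1 : ℝ) • (g q.2 : E)‖⁻¹ •
      ((1 - (q.1 : ℝ)) • (f q.2 : E) + (q.1 : ℝ) • (g q.2 : E)), ?_⟩, ?_⟩, ?_, ?_⟩⟩
  · rw [mem_sphere_zero_iff_norm, norm_smul, norm_inv, norm_norm,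
      inv_mul_cancel₀ (norm_ne_zero_iff.mpr (h q.1 q.2))]
  · refine Continuous.subtype_mk (Continuous.smul (Continuous.inv₀ ?_ fun q : I × X ↦
      norm_ne_zero_iff.mpr (h q.1 q.2)) ?_) _ <;> fun_prop
  · intro x
    ext
    simp
  · intro x
    ext
    simp

/-- The antipodal action of `{1, -1}` on the unit sphere. -/
instance antipodalAction_s14 : MulAction ℤˣ (sphere (0 : E) 1) where
  smul u x := ⟨u • (x : E), by
    rcases Int.units_eq_one_or u with rfl | rfl <;> simp [Units.smul_def]⟩
  one_smul x := Subtype.ext (one_smul _ _)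
  mul_smul u v x := Subtype.ext (mul_smul _ _ _)

theorem coe_antipodal_smul (u : ℤˣ) (x : sphere (0 : E) 1) :
    ((u • x : sphere (0 : E) 1) : E) = u • (x : E) :=
  rfl

instance continuousConstSMul_antipodal : ContinuousConstSMul ℤˣ (sphere (0 : E) 1) where
  continuous_const_smul u := by
    refine Continuous.subtype_mk (f := fun x : sphere (0 : E) 1 ↦ u • (x : E)) ?_ _
    rcases Int.units_eq_one_or u with rfl | rfl
    · simpa using continuous_subtype_val
    · simp only [Units.neg_smul, one_smul]
      fun_prop

theorem exists_nhds_antipodal_disjoint [NormedSpace ℝ E] (x : sphere (0 : E) 1) :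
    ∃ U ∈ nhds x, ∀ u : ℤˣ, ((u • ·) '' U ∩ U).Nonempty → u = 1 := by
  refine ⟨ball x 1, ball_mem_nhds x one_pos, ?_⟩
  rintro u ⟨_, ⟨y, hy, rfl⟩, hy'⟩
  rcases Int.units_eq_one_or u with rfl | rfl
  · rfl
  exfalso
  rw [mem_ball', Subtype.dist_eq, dist_eq_norm] at hy hy'
  have hsum : (x : E) - y + (x - ((-1 : ℤˣ) • y : sphere (0 : E) 1)) = (2 : ℝ) • (x : E) := by
    rw [coe_antipodal_smul, Units.smul_def, two_smul]
    simp
  have hnorm := norm_add_le ((x : E) - y) (x - ((-1 : ℤˣ) • y : sphere (0 : E) 1))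
  rw [hsum, norm_smul, norm_eq_of_mem_sphere] at hnorm
  norm_num at hnorm
  linarith

end Sphere

/-- The right shift of square-summable sequences. -/
noncomputable def rightShift : lp (fun _ : ℕ => ℝ) 2 →ₗᵢ[ℝ] lp (fun _ : ℕ => ℝ) 2 where
  toFun x := ⟨fun n ↦ n.casesOn 0 x, by
    refine memℓp_gen ((summable_nat_add_iff 1).mp ?_)
    exact (lp.memℓp x).summable (by norm_num)⟩
  map_add' x y := by
    ext n
    cases n
    · exact (add_zero (0 : ℝ)).symm
    · rfl
  map_smul' c x := by
    ext n
    cases n <;> simp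
  norm_map' x := by
    have h2 : 0 < (2 : ENNReal).toReal := by norm_num
    rw [← Real.rpow_left_inj (norm_nonneg _) (norm_nonneg _) h2.ne', lp.norm_rpow_eq_tsum h2,
      lp.norm_rpow_eq_tsum h2, Summable.tsum_eq_zero_add ((lp.memℓp _).summable h2)]
    simp

@[simp] theorem rightShift_apply_zero (x : lp (fun _ : ℕ => ℝ) 2) : rightShift x 0 = 0 := rfl

@[simp] theorem rightShift_apply_succ (x : lp (fun _ : ℕ => ℝ) 2) (n : ℕ) :
    rightShift x (n + 1) = x n := rfl

theorem segment_rightShift_ne_zero {x : lp (fun _ : ℕ => ℝ) 2} (hx : x ≠ 0) (t : ℝ) :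
    (1 - t) • x + t • rightShift x ≠ 0 := by
  intro h
  have hcoord (n : ℕ) : (1 - t) * x n + t * rightShift x n = 0 :=
    congr(($h : lp (fun _ : ℕ => ℝ) 2) n)
  apply hx
  ext n
  rcases eq_or_ne t 1 with rfl | ht
  · simpa using hcoord (n + 1)
  induction n with
  | zero => simpa [sub_ne_zero.mpr ht.symm] using hcoord 0
  | succ n ih => simpa [sub_ne_zero.mpr ht.symm, ih] using hcoord (n + 1)

theorem segment_single_ne_zero {x : lp (fun _ : ℕ => ℝ) 2} (hx : x ≠ 0) (t : ℝ) :
    (1 - t) • rightShift x + t • lp.single 2 0 (1 : ℝ) ≠ 0 := by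
  intro h
  have ht : t = 0 := by
    have h0 : (1 - t) * rightShift x 0 + t * lp.single (E := fun _ : ℕ => ℝ) 2 0 1 0 = 0 :=
      congr(($h : lp (fun _ : ℕ => ℝ) 2) 0)
    simpa using h0
  subst ht
  exact hx (rightShift.injective (by simpa using h))

instance contractibleSpace_sphInf : ContractibleSpace SphInf := by
  rw [contractible_iff_id_nullhomotopic]
  let s : C(SphInf, SphInf) :=
    ⟨fun x ↦ ⟨rightShift x, by simp⟩, by fun_prop⟩
  let b : SphInf := ⟨lp.single 2 0 (1 : ℝ), by simp⟩
  have hne (x : SphInf) : (x : lp (fun _ : ℕ => ℝ) 2) ≠ 0 := ne_zero_of_mem_unit_sphere x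
  exact ⟨b, (homotopic_sphere_of_segment_ne_zero _ s fun t x ↦
    segment_rightShift_ne_zero (hne x) t).trans
    (homotopic_sphere_of_segment_ne_zero s _ fun t x ↦ segment_single_ne_zero (hne x) t)⟩

theorem antipodalRelInf_iff {x y : SphInf} : antipodalRelInf x y ↔ y = (-1 : ℤˣ) • x := by
  rw [antipodalRelInf, ← Subtype.coe_inj (a := y), coe_antipodal_smul, Units.smul_def]
  simp

theorem mk_antipodalRelInf_eq_iff {x y : SphInf} :
    Quot.mk antipodalRelInf x = Quot.mk antipodalRelInf y ↔ x ∈ MulAction.orbit ℤˣ y := by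
  constructor
  · intro h
    have hrel : antipodalRelInf ≤ (MulAction.orbitRel ℤˣ SphInf).r := fun a b hab ↦
      (MulAction.orbitRel ℤˣ SphInf).symm ⟨-1, (antipodalRelInf_iff.mp hab).symm⟩
    exact (MulAction.orbitRel ℤˣ SphInf).iseqv.eqvGen_iff.mp
      (Relation.EqvGen.mono hrel _ _ (Quot.eqvGen_exact h))
  · rintro ⟨u, rfl⟩
    rcases Int.units_eq_one_or u with rfl | rfl
    · exact congrArg _ (one_smul _ y)
    · exact (Quot.sound (antipodalRelInf_iff.mpr rfl)).symm

theorem isQuotientCoveringMap_mk_antipodalRelInf :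
    IsQuotientCoveringMap (Quot.mk antipodalRelInf) ℤˣ where
  __ := isQuotientMap_quot_mk
  __ := continuousConstSMul_antipodal
  apply_eq_iff_mem_orbit := mk_antipodalRelInf_eq_iff
  disjoint := exists_nhds_antipodal_disjoint

/-- The fundamental group of `ℝP^∞` is `ℤ/2ℤ`. -/
theorem stmt_14 (y : RPInf) :
    Nonempty (FundamentalGroup RPInf y ≃* Multiplicative (ZMod 2)) := by
  obtain ⟨x, hx⟩ := Quot.exists_rep y
  refine ⟨(isQuotientCoveringMap_mk_antipodalRelInf.fundamentalGroupEquiv ⟨x, hx⟩).trans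
    (mulEquivOfPrimeCardEq (p := 2) ?_ ?_)⟩
  · rw [Nat.card_congr MulOpposite.opEquiv.symm, Nat.card_eq_fintype_card, Fintype.card_units_int]
  · rw [Nat.card_congr Multiplicative.toAdd, Nat.card_zmod]
end

section
/- Let ℝP^∞ be the quotient of S^∞, the unit sphere of ℓ²(ℕ, ℝ), by the relation identifying x with -x, with the quotient topology. Then for every k ≥ 2 and every base point y, the k-th homotopy group of ℝP^∞ at y is trivial (a subsingleton). (Together with π₁ ≅ ℤ/2ℤ, this says ℝP^∞ is an Eilenberg–MacLane space K(ℤ/2ℤ, 1).) -/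
open scoped unitInterval Topology Topology.Homotopy

/-- If the unit sphere of a real normed space is compact, the space is finite-dimensional. -/
theorem finiteDimensional_of_compactSpace_sphere {E : Type*} [NormedAddCommGroup E]
    [NormedSpace ℝ E] [CompactSpace (Metric.sphere (0 : E) 1)] : FiniteDimensional ℝ E := by
  have hS : IsCompact (Metric.sphere (0 : E) 1) := isCompact_iff_compactSpace.mpr inferInstance
  rcases subsingleton_or_nontrivial E with hE | hE
  · infer_instance
  have hB : IsCompact ((fun q : ℝ × E => q.1 • q.2) ''
      (Set.Icc (0 : ℝ) 1 ×ˢ Metric.sphere (0 : E) 1)) :=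
    (isCompact_Icc.prod hS).image (by fun_prop)
  refine FiniteDimensional.of_isCompact_closedBall₀ ℝ zero_lt_one
    (hB.of_isClosed_subset Metric.isClosed_closedBall fun x hx => ?_)
  rw [mem_closedBall_zero_iff] at hx
  by_cases h0 : x = 0
  · obtain ⟨u, hu⟩ := exists_norm_eq E zero_le_one
    exact ⟨(0, u), ⟨by simp, by simpa using hu⟩, by simp [h0]⟩
  · have hn : ‖x‖ ≠ 0 := norm_ne_zero_iff.mpr h0
    exact ⟨(‖x‖, ‖x‖⁻¹ • x), ⟨⟨norm_nonneg x, hx⟩, by simp [norm_smul, hn]⟩,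
      by simp [smul_smul, hn]⟩

/-- A continuous map into a sphere that is not surjective is homotopic to a constant map,
relative to the preimage of that constant. -/
theorem homotopicRel_const_of_notMem_range {E A : Type*} [NormedAddCommGroup E]
    [InnerProductSpace ℝ E] [TopologicalSpace A] (f : C(A, Metric.sphere (0 : E) 1))
    {v : Metric.sphere (0 : E) 1} (hv : v ∉ Set.range f) (a : A) :
    f.HomotopicRel (ContinuousMap.const A (f a)) (f ⁻¹' {f a}) := by
  set φ := stereographic (norm_eq_of_mem_sphere v) with hφ
  have hmem : ∀ x, f x ∈ φ.source := fun x => by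
    rw [hφ, stereographic_source]
    exact fun h => hv ⟨x, h⟩
  have hsymm : Continuous φ.symm := by
    rw [← continuousOn_univ]
    exact φ.continuousOn_symm
  have hcomp : Continuous fun x => φ (f x) :=
    φ.continuousOn.comp_continuous f.continuous hmem
  refine ⟨⟨⟨⟨fun q => φ.symm (AffineMap.lineMap (φ (f q.2)) (φ (f a)) (q.1 : ℝ)), ?_⟩,
    fun x => ?_, fun x => ?_⟩, fun t x hx => ?_⟩⟩
  · simp only [AffineMap.lineMap_apply_module]
    have hsnd : Continuous fun q : I × A => φ (f q.2) := hcomp.comp continuous_snd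
    have hfst : Continuous fun q : I × A => (q.1 : ℝ) := by fun_prop
    exact hsymm.comp (((continuous_const.sub hfst).smul hsnd).add (hfst.smul continuous_const))
  · simp [φ.left_inv (hmem x)]
  · simp [φ.left_inv (hmem a)]
  · have hx' : f x = f a := hx
    simp [hx', φ.left_inv (hmem a)]

/-- Every map from a compact space to the unit sphere of an infinite-dimensional inner product
space is homotopic to a constant map, relative to the preimage of that constant. -/
theorem homotopicRel_const_sphere {E A : Type*} [NormedAddCommGroup E]
    [InnerProductSpace ℝ E] [TopologicalSpace A] [CompactSpace A]
    (hE : ¬ FiniteDimensional ℝ E) (f : C(A, Metric.sphere (0 : E) 1)) (a : A) :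
    f.HomotopicRel (ContinuousMap.const A (f a)) (f ⁻¹' {f a}) := by
  have hf : ¬ Function.Surjective f := fun hsurj => hE <| by
    have : CompactSpace (Metric.sphere (0 : E) 1) := hsurj.compactSpace f.continuous
    exact finiteDimensional_of_compactSpace_sphere
  rw [← Set.range_eq_univ, Set.eq_univ_iff_forall] at hf
  push Not at hf
  obtain ⟨v, hv⟩ := hf
  exact homotopicRel_const_of_notMem_range f hv a

/-- Maps from a cube lift through covering maps. -/
theorem IsCoveringMap.exists_lift_cube {N E X : Type*} [TopologicalSpace E] [TopologicalSpace X]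
    {p : E → X} (hp : IsCoveringMap p) (f : C(I^N, X)) (e : E) (he : p e = f 0) :
    ∃ F : C(I^N, E), p ∘ F = f := by
  let H : C(I × (I^N), X) := ⟨fun q => f fun i => q.1 * q.2 i, by fun_prop⟩
  have H_zero : ∀ x, H (0, x) = p (ContinuousMap.const (I^N) e x) := fun x => by
    simp only [H, ContinuousMap.coe_mk, zero_mul, ContinuousMap.const_apply, he]
    rfl
  refine ⟨(hp.liftHomotopy H _ H_zero).comp ⟨fun x => (1, x), by fun_prop⟩, ?_⟩
  funext x
  have := congrFun (hp.liftHomotopy_lifts H _ H_zero) (1, x)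
  simpa [H] using this

/-- A face of a cube is preconnected. -/
theorem Cube.isPreconnected_face {N : Type*} [DecidableEq N] (i : N) (c : I) :
    IsPreconnected {x : I^N | x i = c} := by
  have : {x : I^N | x i = c} = Set.range fun x : I^N => Function.update x i c := by
    ext x
    refine ⟨fun hx => ⟨x, ?_⟩, ?_⟩
    · simp [← show x i = c from hx]
    · rintro ⟨y, rfl⟩
      simp
  rw [this]
  exact isPreconnected_range (by fun_prop)

/-- The boundary of a cube of dimension at least two is preconnected. -/
theorem Cube.isPreconnected_boundary (N : Type*) [DecidableEq N] [Nontrivial N] :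
    IsPreconnected (Cube.boundary N) := by
  refine isPreconnected_of_forall (0 : I^N) fun x ⟨i, hx⟩ => ?_
  obtain ⟨j, hj⟩ := exists_ne i
  refine ⟨{y | y i = x i} ∪ {y | y j = 0}, ?_, Or.inr rfl, Or.inl rfl, ?_⟩
  · rintro y (hy | hy)
    · exact ⟨i, by rwa [show y i = x i from hy]⟩
    · exact ⟨j, Or.inl hy⟩
  · exact (Cube.isPreconnected_face i _).union (Function.update x j 0)
      (by simp [hj.symm]) (by simp) (Cube.isPreconnected_face j _)

theorem quot_mk_antipodalRelInf_eq_iff {x y : SphInf} :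
    Quot.mk antipodalRelInf x = Quot.mk antipodalRelInf y ↔ x = y ∨ x = -y := by
  constructor
  · intro h
    rw [Quot.eq] at h
    induction h with
    | rel x y h =>
      right
      rw [show y = -x from Subtype.ext h, neg_neg]
    | refl x => exact Or.inl rfl
    | symm x y _ ih =>
      rcases ih with rfl | rfl
      · exact Or.inl rfl
      · exact Or.inr (neg_neg y).symm
    | trans x y z _ _ ih₁ ih₂ =>
      rcases ih₁ with rfl | rfl <;> rcases ih₂ with rfl | rfl <;> simp
  · rintro (rfl | rfl)
    · rfl
    · exact (Quot.sound (show antipodalRelInf y (-y) from rfl)).symm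

theorem eq_one_or_eq_neg_one_of_sphere_real (g : Metric.sphere (0 : ℝ) 1) : g = 1 ∨ g = -1 := by
  have h : |(g : ℝ)| = 1 := norm_eq_of_mem_sphere g
  exact (eq_or_eq_neg_of_abs_eq h).imp (fun h => Subtype.ext h) fun h => Subtype.ext h

theorem neg_one_smul_sphInf (x : SphInf) : (-1 : Metric.sphere (0 : ℝ) 1) • x = -x :=
  Subtype.ext (neg_one_smul ℝ (x : lp (fun _ : ℕ => ℝ) 2))

/-- The antipodal quotient map `S^∞ → ℝP^∞` is a covering map. -/
theorem isCoveringMap_quot_mk_antipodalRelInf : IsCoveringMap (Quot.mk antipodalRelInf) := by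
  have h : IsQuotientCoveringMap (Quot.mk antipodalRelInf) (Metric.sphere (0 : ℝ) 1) :=
    { toIsQuotientMap := isQuotientMap_quot_mk
      toContinuousConstSMul := inferInstance
      apply_eq_iff_mem_orbit := fun {x y} => by
        rw [quot_mk_antipodalRelInf_eq_iff, MulAction.mem_orbit_iff]
        constructor
        · rintro (rfl | rfl)
          · exact ⟨1, one_smul _ _⟩
          · exact ⟨-1, neg_one_smul_sphInf y⟩
        · rintro ⟨g, rfl⟩
          rcases eq_one_or_eq_neg_one_of_sphere_real g with rfl | rfl
          · exact Or.inl (one_smul _ _)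
          · exact Or.inr (neg_one_smul_sphInf y)
      disjoint := fun e => by
        refine ⟨Metric.ball e 1, Metric.ball_mem_nhds e one_pos, fun g => ?_⟩
        rintro ⟨_, ⟨u, hu, rfl⟩, hgu⟩
        refine (eq_one_or_eq_neg_one_of_sphere_real g).resolve_right ?_
        rintro rfl
        simp only [neg_one_smul_sphInf] at hgu
        have hlt : dist u (-u) < 2 := by
          linarith [dist_triangle_right u (-u) e, Metric.mem_ball.mp hu, Metric.mem_ball.mp hgu]
        have htwo : dist u (-u) = 2 := by
          rw [Subtype.dist_eq, coe_neg_sphere, dist_eq_norm, sub_neg_eq_add, ← two_smul ℝ,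
            norm_smul, norm_eq_of_mem_sphere u]
          norm_num
        exact hlt.ne htwo }
  exact h.isCoveringMap

theorem not_finiteDimensional_l2 : ¬ FiniteDimensional ℝ (lp (fun _ : ℕ => ℝ) 2) := by
  intro h
  let b : HilbertBasis ℕ ℝ (lp (fun _ : ℕ => ℝ) 2) := .ofRepr (LinearIsometryEquiv.refl ℝ _)
  have := b.orthonormal.linearIndependent.finite
  exact not_finite ℕ

/-- For `k ≥ 2`, the `k`-th homotopy group of `ℝP^∞` is trivial. -/
theorem stmt_15 (k : ℕ) (hk : 2 ≤ k) (y : RPInf) :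
    Subsingleton (HomotopyGroup (Fin k) RPInf y) := by
  have : Nontrivial (Fin k) := Fin.nontrivial_iff_two_le.mpr hk
  have hp := isCoveringMap_quot_mk_antipodalRelInf
  obtain ⟨e, rfl⟩ := Quot.exists_rep y
  refine subsingleton_of_forall_eq
    (Quotient.mk (GenLoop.Homotopic.setoid (Fin k) _) GenLoop.const) fun q => ?_
  induction q using Quotient.inductionOn with
  | _ f =>
  have h0 : (0 : I^(Fin k)) ∈ Cube.boundary (Fin k) := ⟨⟨0, by omega⟩, Or.inl rfl⟩
  obtain ⟨F, hF⟩ := hp.exists_lift_cube f.1 e (f.2 0 h0).symm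
  have hb : ∀ x ∈ Cube.boundary (Fin k), Quot.mk antipodalRelInf (F x) = Quot.mk _ e :=
    fun x hx => (congrFun hF x).trans (f.2 x hx)
  have hconst : Cube.boundary (Fin k) ⊆ F ⁻¹' {F 0} := fun x hx =>
    hp.constOn_of_comp (Cube.isPreconnected_boundary (Fin k)) F.continuous.continuousOn
      (fun a ha b hb' => (hb a ha).trans (hb b hb').symm) hx h0
  obtain ⟨H⟩ := homotopicRel_const_sphere not_finiteDimensional_l2 F 0
  have hH : F.HomotopicRel (ContinuousMap.const _ (F 0)) (Cube.boundary (Fin k)) :=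
    ⟨⟨H.toHomotopy, fun t x hx => H.prop' t x (hconst hx)⟩⟩
  obtain ⟨K⟩ := hH
  refine Quotient.sound ⟨(K.compContinuousMap ⟨Quot.mk antipodalRelInf, hp.continuous⟩).cast
    ?_ ?_⟩
  · ext x
    exact congrFun hF x
  · ext x
    exact hb 0 h0
end
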